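/- Let A ≺ B be binary pattern matrices in {0,1}^{n×k}, meaning b_{ij} = 0 implies a_{ij} = 0 for all i, j. For a pattern matrix P, let N_FR(P) denote the number of matrices in S(P,q) (matrices over F_q respecting the zero pattern P) with full rank min(n,k). Then N_FR(A)/q^{wt(A)} ≤ N_FR(B)/q^{wt(B)}; i.e., the full rank probability under the quasi-uniform distribution U(A,q) is at most that under U(B,q). -/

import Mathlib

/-- The support set S(B,q): matrices over F vanishing wherever the binary
pattern B is zero (false). -/
def patternSupport (F : Type*) [Field F] {n k : ℕ} (B : Matrix (Fin n) (Fin k) Bool) :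
    Set (Matrix (Fin n) (Fin k) F) :=
  {M | ∀ i j, B i j = false → M i j = 0}

/-- The weight of a binary pattern: the number of entries equal to one (true). -/
def patternWeight {n k : ℕ} (B : Matrix (Fin n) (Fin k) Bool) : ℕ :=
  (Finset.univ.filter (fun p : Fin n × Fin k => B p.1 p.2 = true)).card

/-- The number of full-rank matrices respecting the zero pattern P. -/
noncomputable def numFullRank (F : Type*) [Field F] [Fintype F] {n k : ℕ}
    (P : Matrix (Fin n) (Fin k) Bool) : ℕ :=
  Nat.card {M : Matrix (Fin n) (Fin k) F // M ∈ patternSupport F P ∧ M.rank = min n k}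

open Classical in
/-- The probability mass function of the uniform distribution on a finite additive subgroup. -/
noncomputable def AddSubgroup.uniformWeight {G : Type*} [AddGroup G] (V : AddSubgroup G) (x : G) :
    ℚ :=
  if x ∈ V then (Nat.card V : ℚ)⁻¹ else 0

theorem AddSubgroup.uniformWeight_nonneg {G : Type*} [AddGroup G] (V : AddSubgroup G) (x : G) :
    0 ≤ V.uniformWeight x := by
  unfold AddSubgroup.uniformWeight
  split_ifs <;> positivity

/-- The probability that a uniform element of `V` avoids `W` is `1 - 1 / [V : V ∩ W]`. -/
theorem AddSubgroup.sum_uniformWeight_notMem {G : Type*} [AddGroup G] [Fintype G]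
    (V W : AddSubgroup G) [DecidablePred (· ∉ W)] :
    ∑ x, V.uniformWeight x * (if x ∉ W then (1 : ℚ) else 0) = 1 - (W.relIndex V : ℚ)⁻¹ := by
  classical
  have hV : (Nat.card V : ℚ) ≠ 0 := by exact_mod_cast Nat.card_pos.ne'
  have hr : (W.relIndex V : ℚ) ≠ 0 := by
    exact_mod_cast (W.addSubgroupOf _).index_ne_zero_of_finite
  have hmul : (Nat.card (W ⊓ V : AddSubgroup G) : ℚ) * W.relIndex V = Nat.card V := by
    have h := AddSubgroup.relIndex_mul_relIndex ⊥ (W ⊓ V) V bot_le inf_le_right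
    rw [AddSubgroup.relIndex_bot_left, AddSubgroup.relIndex_bot_left,
      AddSubgroup.inf_relIndex_right] at h
    exact_mod_cast h
  have hcard (U : AddSubgroup G) : ∑ x, (if x ∈ U then (1 : ℚ) else 0) = Nat.card U := by
    rw [Finset.sum_boole, Nat.card_eq_fintype_card, Fintype.card_subtype]
  have hterm (x : G) : V.uniformWeight x * (if x ∉ W then (1 : ℚ) else 0) =
      (Nat.card V : ℚ)⁻¹ * ((if x ∈ V then 1 else 0) - if x ∈ W ⊓ V then 1 else 0) := by
    by_cases h₁ : x ∈ V <;> by_cases h₂ : x ∈ W <;>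
      simp [AddSubgroup.uniformWeight, AddSubgroup.mem_inf, h₁, h₂]
  rw [Finset.sum_congr rfl fun x _ => hterm x, ← Finset.mul_sum, Finset.sum_sub_distrib, hcard,
    hcard, mul_sub, inv_mul_cancel₀ hV, ← hmul]
  have hi : (Nat.card (W ⊓ V : AddSubgroup G) : ℚ) ≠ 0 := by exact_mod_cast Nat.card_pos.ne'
  field_simp

theorem AddSubgroup.sum_uniformWeight_notMem_mono {G : Type*} [AddGroup G] [Fintype G]
    {V V' : AddSubgroup G} (h : V ≤ V') (W : AddSubgroup G) [DecidablePred (· ∉ W)] :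
    ∑ x, V.uniformWeight x * (if x ∉ W then (1 : ℚ) else 0) ≤
      ∑ x, V'.uniformWeight x * (if x ∉ W then (1 : ℚ) else 0) := by
  rw [AddSubgroup.sum_uniformWeight_notMem, AddSubgroup.sum_uniformWeight_notMem]
  have hV' : W.relIndex V' ≠ 0 := (W.addSubgroupOf _).index_ne_zero_of_finite
  have hV : W.relIndex V ≠ 0 := (W.addSubgroupOf _).index_ne_zero_of_finite
  have hle : (W.relIndex V : ℚ) ≤ W.relIndex V' := by
    exact_mod_cast AddSubgroup.relIndex_le_of_le_right h hV'
  have hpos : (0 : ℚ) < W.relIndex V := by exact_mod_cast Nat.pos_of_ne_zero hV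
  gcongr

/-- Product weights may be compared one coordinate at a time. -/
theorem sum_prod_mul_le_of_update {X : Type*} [Fintype X] {n : ℕ} (w w' : Fin n → X → ℚ)
    (hw : ∀ i x, 0 ≤ w i x) (hw' : ∀ i x, 0 ≤ w' i x) (f : (Fin n → X) → ℚ)
    (hf : ∀ r i, ∑ x, w i x * f (Function.update r i x) ≤
      ∑ x, w' i x * f (Function.update r i x)) :
    ∑ r : Fin n → X, (∏ i, w i (r i)) * f r ≤ ∑ r : Fin n → X, (∏ i, w' i (r i)) * f r := by
  induction n with
  | zero => simp
  | succ n ih =>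
    have hsplit (v : Fin (n + 1) → X → ℚ) :
        ∑ r : Fin (n + 1) → X, (∏ i, v i (r i)) * f r =
          ∑ x, v 0 x * ∑ t : Fin n → X, (∏ i, v i.succ (t i)) * f (Fin.cons x t) := by
      rw [← (Fin.consEquiv fun _ => X).sum_comp, Fintype.sum_prod_type]
      simp [Fin.consEquiv, Fin.prod_univ_succ, Finset.mul_sum, mul_assoc]
    rw [hsplit, hsplit]
    calc _ ≤ ∑ x, w 0 x * ∑ t : Fin n → X, (∏ i, w' i.succ (t i)) * f (Fin.cons x t) := by
          refine Finset.sum_le_sum fun x _ => mul_le_mul_of_nonneg_left ?_ (hw 0 x)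
          refine ih (fun i => w i.succ) (fun i => w' i.succ) (fun i => hw _) (fun i => hw' _)
            (fun t => f (Fin.cons x t)) fun t i => ?_
          simpa only [Fin.cons_update] using hf (Fin.cons x t) i.succ
      _ = ∑ t : Fin n → X, (∏ i, w' i.succ (t i)) * ∑ x, w 0 x * f (Fin.cons x t) := by
          simp only [Finset.mul_sum]
          rw [Finset.sum_comm]
          exact Finset.sum_congr rfl fun t _ => Finset.sum_congr rfl fun x _ => by ring
      _ ≤ ∑ t : Fin n → X, (∏ i, w' i.succ (t i)) * ∑ x, w' 0 x * f (Fin.cons x t) := by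
          refine Finset.sum_le_sum fun t _ => mul_le_mul_of_nonneg_left ?_
            (Finset.prod_nonneg fun i _ => hw' _ _)
          rcases isEmpty_or_nonempty X with hX | ⟨⟨x₀⟩⟩
          · simp
          · simpa only [Fin.update_cons_zero] using hf (Fin.cons x₀ t) 0
      _ = _ := by
          simp only [Finset.mul_sum]
          rw [Finset.sum_comm]
          exact Finset.sum_congr rfl fun t _ => Finset.sum_congr rfl fun x _ => by ring

/-- With all other vectors of a family fixed, the values of the remaining vector which destroy
linear independence form a subspace. -/
theorem exists_submodule_linearIndependent_update_iff {ι K V : Type*} [DecidableEq ι]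
    [DivisionRing K] [AddCommGroup V] [Module K V] (r : ι → V) (i : ι) :
    ∃ W : Submodule K V, ∀ x, LinearIndependent K (Function.update r i x) ↔ x ∉ W := by
  have heq (x : V) : Set.EqOn (Function.update r i x) r {i}ᶜ := fun j hj =>
    Function.update_of_ne hj _ _
  have key (x : V) : LinearIndependent K (Function.update r i x) ↔
      LinearIndepOn K r {i}ᶜ ∧ x ∉ Submodule.span K (r '' {i}ᶜ) := by
    rw [← linearIndepOn_univ_iff, ← Set.union_compl_self {i}, Set.singleton_union,
      linearIndepOn_insert (by simp), linearIndepOn_congr (heq x), (heq x).image_eq,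
      Function.update_self]
  by_cases h : LinearIndepOn K r {i}ᶜ
  · exact ⟨_, fun x => (key x).trans (and_iff_right h)⟩
  · exact ⟨⊤, fun x => by simp [key, h]⟩

/-- The vectors vanishing wherever the binary row `p` is zero. -/
def rowSupport (F : Type*) [Field F] {k : ℕ} (p : Fin k → Bool) : AddSubgroup (Fin k → F) where
  carrier := {v | ∀ j, p j = false → v j = 0}
  add_mem' ha hb j hj := by simp [ha j hj, hb j hj]
  zero_mem' _ _ := rfl
  neg_mem' ha j hj := by simp [ha j hj]

theorem mem_rowSupport {F : Type*} [Field F] {k : ℕ} {p : Fin k → Bool} {v : Fin k → F} :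
    v ∈ rowSupport F p ↔ ∀ j, p j = false → v j = 0 := Iff.rfl

theorem card_rowSupport (F : Type*) [Field F] [Fintype F] {k : ℕ} (p : Fin k → Bool) :
    Nat.card (rowSupport F p) = Fintype.card F ^ (Finset.univ.filter fun j => p j = true).card := by
  classical
  have h : (Finset.univ.filter fun v => v ∈ rowSupport F p) =
      Fintype.piFinset fun j => if p j = true then Finset.univ else {0} := by
    ext v
    simp only [Finset.mem_filter_univ, mem_rowSupport, Fintype.mem_piFinset]
    refine forall_congr' fun j => ?_
    cases p j <;> simp
  rw [Nat.card_eq_fintype_card, Fintype.card_subtype, h, Fintype.card_piFinset]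
  simp [apply_ite Finset.card, Finset.prod_ite]

theorem prod_card_rowSupport (F : Type*) [Field F] [Fintype F] {n k : ℕ}
    (P : Matrix (Fin n) (Fin k) Bool) :
    ∏ i, Nat.card (rowSupport F (P i)) = Fintype.card F ^ patternWeight P := by
  simp_rw [card_rowSupport, Finset.prod_pow_eq_pow_sum, patternWeight, Finset.card_filter,
    Fintype.sum_prod_type]

theorem Matrix.rank_eq_card_iff_linearIndependent {F m n : Type*} [Field F] [Fintype m]
    [Fintype n] (M : Matrix m n F) : M.rank = Fintype.card m ↔ LinearIndependent F M.row := by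
  rw [Matrix.rank_eq_finrank_span_row, eq_comm]
  exact linearIndependent_iff_card_eq_finrank_span.symm

open Classical in
theorem numFullRank_div_eq_sum (F : Type*) [Field F] [Fintype F] {n k : ℕ} (hnk : n ≤ k)
    (P : Matrix (Fin n) (Fin k) Bool) :
    (numFullRank F P : ℚ) / (Fintype.card F : ℚ) ^ patternWeight P =
      ∑ r : Fin n → Fin k → F, (∏ i, (rowSupport F (P i)).uniformWeight (r i)) *
        if LinearIndependent F r then 1 else 0 := by
  have hterm (r : Fin n → Fin k → F) :
      ((∏ i, (rowSupport F (P i)).uniformWeight (r i)) *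
        if LinearIndependent F r then (1 : ℚ) else 0) =
      if (Matrix.of r ∈ patternSupport F P ∧ (Matrix.of r).rank = min n k) then
        ((Fintype.card F : ℚ) ^ patternWeight P)⁻¹ else 0 := by
    have hrank : (Matrix.of r).rank = min n k ↔ LinearIndependent F r := by
      rw [min_eq_left hnk]
      simpa using (Matrix.of r).rank_eq_card_iff_linearIndependent
    have hmem : Matrix.of r ∈ patternSupport F P ↔ ∀ i, r i ∈ rowSupport F (P i) := Iff.rfl
    simp only [hrank, hmem]
    by_cases hr : ∀ i, r i ∈ rowSupport F (P i)
    · have hprod : ∏ i, (rowSupport F (P i)).uniformWeight (r i) =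
          ((Fintype.card F : ℚ) ^ patternWeight P)⁻¹ := by
        simp only [AddSubgroup.uniformWeight, hr, if_true]
        rw [Finset.prod_inv_distrib]
        exact_mod_cast congrArg (fun a : ℕ => (a : ℚ)⁻¹) (prod_card_rowSupport F P)
      rw [hprod]
      by_cases hl : LinearIndependent F r <;> simp [hl, hr]
    · obtain ⟨i, hi⟩ := not_forall.mp hr
      rw [Finset.prod_eq_zero (Finset.mem_univ i) (by simp [AddSubgroup.uniformWeight, hi])]
      simp [hr]
  rw [Finset.sum_congr rfl fun r _ => hterm r, ← Finset.sum_filter, Finset.sum_const,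
    nsmul_eq_mul, div_eq_mul_inv, numFullRank, Nat.card_eq_fintype_card, Fintype.card_subtype]
  rfl

theorem numFullRank_div_le_of_le (F : Type*) [Field F] [Fintype F] {n k : ℕ} (hnk : n ≤ k)
    (A B : Matrix (Fin n) (Fin k) Bool) (hAB : ∀ i j, B i j = false → A i j = false) :
    (numFullRank F A : ℚ) / (Fintype.card F : ℚ) ^ patternWeight A ≤
      (numFullRank F B : ℚ) / (Fintype.card F : ℚ) ^ patternWeight B := by
  classical
  rw [numFullRank_div_eq_sum F hnk, numFullRank_div_eq_sum F hnk]
  refine sum_prod_mul_le_of_update _ _ (fun _ => AddSubgroup.uniformWeight_nonneg _)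
    (fun _ => AddSubgroup.uniformWeight_nonneg _) _ fun r i => ?_
  obtain ⟨W, hW⟩ := exists_submodule_linearIndependent_update_iff (K := F) r i
  simp only [hW]
  have hle : rowSupport F (A i) ≤ rowSupport F (B i) := fun v hv j hj => hv j (hAB i j hj)
  exact AddSubgroup.sum_uniformWeight_notMem_mono hle W.toAddSubgroup

theorem patternWeight_transpose {n k : ℕ} (P : Matrix (Fin n) (Fin k) Bool) :
    patternWeight P.transpose = patternWeight P := by
  exact Finset.card_equiv (Equiv.prodComm _ _) fun p => by
    rw [Finset.mem_filter_univ, Finset.mem_filter_univ]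
    rfl

theorem numFullRank_transpose (F : Type*) [Field F] [Fintype F] {n k : ℕ}
    (P : Matrix (Fin n) (Fin k) Bool) :
    numFullRank F P.transpose = numFullRank F P := by
  refine Nat.card_congr ((Matrix.transposeAddEquiv _ _ F).toEquiv.subtypeEquiv fun M => ?_)
  refine and_congr forall_comm ?_
  simp [Matrix.rank_transpose, min_comm]

/-- If A ≺ B (every zero of B is a zero of A), then the full-rank probability
under U(A,q) is at most that under U(B,q):
N_FR(A)/q^{wt(A)} ≤ N_FR(B)/q^{wt(B)}. -/
theorem stmt8 (F : Type*) [Field F] [Fintype F] (q n k : ℕ)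
    (hq : Fintype.card F = q)
    (A B : Matrix (Fin n) (Fin k) Bool)
    (hAB : ∀ i j, B i j = false → A i j = false) :
    (numFullRank F A : ℚ) / (q : ℚ) ^ patternWeight A ≤
      (numFullRank F B : ℚ) / (q : ℚ) ^ patternWeight B := by
  subst hq
  rcases le_total n k with hnk | hkn
  · exact numFullRank_div_le_of_le F hnk A B hAB
  · simpa only [numFullRank_transpose, patternWeight_transpose] using
      numFullRank_div_le_of_le F hkn A.transpose B.transpose fun i j => hAB j i
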